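/- (Concave surrogate lower bound for the rate, with tightness at the anchor.) Let x₀ ≥ 0 and y₀ > 0, and define ζ = x₀²/y₀ and ι = Real.sqrt(1 + ζ)·x₀/(x₀² + y₀). Then for all x ≥ 0 and y > 0: Real.log(1 + x²/y) ≥ Real.log(1 + ζ) − ζ + 2·ι·Real.sqrt(1 + ζ)·x − ι²·(x² + y), and equality holds at (x, y) = (x₀, y₀). -/

import Mathlib

/-- The surrogate bounds the rate from below for every multiplier `ι` and every `ζ > -1`. -/
lemma log_one_add_sq_div_ge_surrogate {ζ x y : ℝ} (ι : ℝ) (hζ : 0 < 1 + ζ) (hy : 0 < y) :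
    Real.log (1 + ζ) - ζ + 2 * ι * Real.sqrt (1 + ζ) * x - ι ^ 2 * (x ^ 2 + y) ≤
      Real.log (1 + x ^ 2 / y) := by
  have hT : 0 < x ^ 2 + y := by positivity
  have hu : 0 < 1 + x ^ 2 / y := by positivity
  have hs : Real.sqrt (1 + ζ) ^ 2 = 1 + ζ := Real.sq_sqrt hζ.le
  have hquad : 2 * ι * Real.sqrt (1 + ζ) * x - ι ^ 2 * (x ^ 2 + y) ≤
      (1 + ζ) * x ^ 2 / (x ^ 2 + y) := by
    rw [le_div_iff₀ hT]
    linear_combination sq_nonneg (Real.sqrt (1 + ζ) * x - ι * (x ^ 2 + y)) + x ^ 2 * hs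
  have hlog := Real.log_le_sub_one_of_pos (div_pos hζ hu)
  rw [Real.log_div hζ.ne' hu.ne'] at hlog
  have hfrac : (1 + ζ) * x ^ 2 / (x ^ 2 + y) = 1 + ζ - (1 + ζ) / (1 + x ^ 2 / y) := by
    have : 1 + x ^ 2 / y = (x ^ 2 + y) / y := by field_simp; ring
    rw [this]
    field_simp
    ring
  linarith


/-- concave surrogate lower bound for the rate, with tightness at the
anchor: for `x₀ ≥ 0`, `y₀ > 0`, `ζ = x₀²/y₀`, `ι = √(1+ζ)·x₀/(x₀² + y₀)`, every
`x ≥ 0`, `y > 0` satisfy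
`log(1 + x²/y) ≥ log(1+ζ) − ζ + 2ι√(1+ζ)x − ι²(x² + y)`, with equality at `(x₀, y₀)`. -/
theorem sca_surrogate_lower_bound (x₀ y₀ : ℝ) (hx₀ : 0 ≤ x₀) (hy₀ : 0 < y₀)
    (ζ ι : ℝ) (hζ : ζ = x₀ ^ 2 / y₀) (hι : ι = Real.sqrt (1 + ζ) * x₀ / (x₀ ^ 2 + y₀)) :
    (∀ x y : ℝ, 0 ≤ x → 0 < y →
      Real.log (1 + x ^ 2 / y) ≥
        Real.log (1 + ζ) - ζ + 2 * ι * Real.sqrt (1 + ζ) * x - ι ^ 2 * (x ^ 2 + y)) ∧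
    Real.log (1 + x₀ ^ 2 / y₀) =
      Real.log (1 + ζ) - ζ + 2 * ι * Real.sqrt (1 + ζ) * x₀ - ι ^ 2 * (x₀ ^ 2 + y₀) := by
  have hT : 0 < x₀ ^ 2 + y₀ := by positivity
  have hpos : 0 < 1 + ζ := by rw [hζ]; positivity
  have hs : Real.sqrt (1 + ζ) ^ 2 = 1 + ζ := Real.sq_sqrt hpos.le
  have hdiv : (1 + ζ) / (x₀ ^ 2 + y₀) = 1 / y₀ := by
    rw [hζ]; field_simp; ring
  refine ⟨fun x y _ hy => log_one_add_sq_div_ge_surrogate ι hpos hy, ?_⟩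
  have hlin : ι * Real.sqrt (1 + ζ) * x₀ = ζ := by
    calc ι * Real.sqrt (1 + ζ) * x₀
        = Real.sqrt (1 + ζ) ^ 2 / (x₀ ^ 2 + y₀) * x₀ ^ 2 := by rw [hι]; ring
      _ = ζ := by rw [hs, hdiv, hζ]; ring
  have hsq : ι ^ 2 * (x₀ ^ 2 + y₀) = ζ := by
    have hmul : ι * (x₀ ^ 2 + y₀) = Real.sqrt (1 + ζ) * x₀ := by
      rw [hι, div_mul_cancel₀ _ hT.ne']
    linear_combination ι * hmul + hlin
  rw [← hζ]
  linear_combination hsq - 2 * hlin
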